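/- arXiv:0908.0640 — 4 statements merged into one kernel-verified Lean document; each statement's English description precedes it below -/
import Mathlib

section
/- Let n ≥ 1 and let A = (a_{ij}) be an n×n matrix over ℂ. In the exterior algebra Λ(ℂ^{2n}) with standard basis vectors e_1,…,e_n,f_1,…,f_n, set ω := i·Σ_{1≤i,j≤n} a_{ij} e_i ∧ f_j. Then ω^{n-1} = (n-1)! · i^{(n-1)^2} · Σ_{1≤i,j≤n} (-1)^{i+j} c_{ij} · (e_1∧…∧ê_i∧…∧e_n) ∧ (f_1∧…∧f̂_j∧…∧f_n), where c_{ij} = (-1)^{i+j} det(A^{(i,j)}) is the (i,j) cofactor of A, A^{(i,j)} denotes A with row i and column j deleted, and ê_i (resp. f̂_j) means that the factor e_i (resp. f_j) is omitted from the wedge product. -/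
open ExteriorAlgebra

/-- The basis vector `e i` of `Λ(ℂ^{2n})`: the image under `ι` of the `i`-th standard
basis vector of the first summand of `ℂ^{2n} = ℂ^n ⊕ ℂ^n`. -/
noncomputable def eVec (n : ℕ) (i : Fin n) :
    ExteriorAlgebra ℂ ((Fin n ⊕ Fin n) → ℂ) :=
  ι ℂ (Pi.single (Sum.inl i) 1)

/-- The basis vector `f j` of `Λ(ℂ^{2n})`: the image under `ι` of the `j`-th standard
basis vector of the second summand of `ℂ^{2n} = ℂ^n ⊕ ℂ^n`. -/
noncomputable def fVec (n : ℕ) (j : Fin n) :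
    ExteriorAlgebra ℂ ((Fin n ⊕ Fin n) → ℂ) :=
  ι ℂ (Pi.single (Sum.inr j) 1)

/-- `e_1 ∧ … ∧ ê_i ∧ … ∧ e_n` : the ordered wedge of all `e_k` with the factor `e_i`
omitted. -/
noncomputable def hatE (n : ℕ) (i : Fin n) :
    ExteriorAlgebra ℂ ((Fin n ⊕ Fin n) → ℂ) :=
  (((List.finRange n).filter (fun k => k ≠ i)).map (eVec n)).prod

/-- `f_1 ∧ … ∧ f̂_j ∧ … ∧ f_n` : the ordered wedge of all `f_l` with the factor `f_j`
omitted. -/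
noncomputable def hatF (n : ℕ) (j : Fin n) :
    ExteriorAlgebra ℂ ((Fin n ⊕ Fin n) → ℂ) :=
  (((List.finRange n).filter (fun l => l ≠ j)).map (fVec n)).prod

/-- The `(i,j)` cofactor of `A` : `c_{ij} = (-1)^{i+j} det(A^{(i,j)})`, where `A^{(i,j)}`
is `A` with row `i` and column `j` deleted. -/
noncomputable def cofactor (n : ℕ) (A : Matrix (Fin (n + 1)) (Fin (n + 1)) ℂ)
    (i j : Fin (n + 1)) : ℂ :=
  (-1 : ℂ) ^ ((i : ℕ) + (j : ℕ)) * (A.submatrix i.succAbove j.succAbove).det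

section helpers

variable {M : Type*} [AddCommGroup M] [Module ℂ M]

lemma aux_sum_inj {N : Type*} [AddCommMonoid N] (n : ℕ) (F : (Fin n → Fin (n + 1)) → N)
    (hF : ∀ s, ¬ Function.Injective s → F s = 0) :
    ∑ s, F s = ∑ i : Fin (n + 1), ∑ σ : Equiv.Perm (Fin n), F (i.succAbove ∘ σ) := by
  rw [← Fintype.sum_prod_type' (f := fun (i : Fin (n + 1)) (σ : Equiv.Perm (Fin n)) =>
    F (i.succAbove ∘ σ))]
  symm
  refine Finset.sum_of_injOn (fun p : Fin (n + 1) × Equiv.Perm (Fin n) => p.1.succAbove ∘ p.2)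
    ?_ (fun _ _ => by simp) ?_ (fun _ _ => rfl)
  · rintro ⟨i, σ⟩ - ⟨j, τ⟩ - h
    simp only at h
    have hr : ∀ (i : Fin (n + 1)) (σ : Equiv.Perm (Fin n)),
        Set.range (i.succAbove ∘ σ) = {i}ᶜ := by
      intro i σ
      rw [σ.surjective.range_comp, Fin.range_succAbove]
    have hij : i = j := by
      have := hr i σ
      rw [h, hr j τ] at this
      simpa using this.symm
    subst hij
    congr 1
    ext k
    have := congrFun h k
    simp only [Function.comp_apply, Fin.succAbove_right_inj] at this
    rw [this]
  · intro s _ hs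
    apply hF
    intro hinj
    apply hs
    have hns : ¬ Function.Surjective s := by
      intro hsurj
      have := Fintype.card_le_of_surjective s hsurj
      simp at this
    simp only [Function.Surjective, not_forall, not_exists] at hns
    obtain ⟨i, hi⟩ := hns
    choose t ht using fun k => Fin.exists_succAbove_eq (hi k)
    have htinj : Function.Injective t := by
      intro a b hab
      apply hinj
      rw [← ht a, ← ht b, hab]
    refine ⟨(i, Equiv.ofBijective t (Finite.injective_iff_bijective.mp htinj)), by simp, ?_⟩
    ext k
    simp [ht]

lemma aux_comm (n : ℕ) (v : M) (w : Fin n → M) :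
    ι ℂ v * ιMulti ℂ n w = (-1 : ℂ) ^ n • (ιMulti ℂ n w * ι ℂ v) := by
  induction n with
  | zero => simp
  | succ n ih =>
    have h1 : ι ℂ v * ι ℂ (w 0) = - (ι ℂ (w 0) * ι ℂ v) :=
      eq_neg_of_add_eq_zero_left (ι_add_mul_swap v (w 0))
    rw [ιMulti_succ_apply, ← mul_assoc, h1, neg_mul, mul_assoc, ih, mul_smul_comm, pow_succ,
      mul_assoc]
    simp

lemma aux_pow {κ : Type*} [Fintype κ] (n : ℕ) (e g : κ → M) :
    (∑ i, ι ℂ (e i) * ι ℂ (g i)) ^ n = (-1 : ℂ) ^ (∑ k ∈ Finset.range n, k) •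
      ∑ s : Fin n → κ, ιMulti ℂ n (e ∘ s) * ιMulti ℂ n (g ∘ s) := by
  induction n with
  | zero => simp
  | succ n ih =>
    rw [pow_succ', ih, ← Equiv.sum_comp (Fin.consEquiv (fun _ : Fin (n + 1) => κ))
      (fun s => ιMulti ℂ (n + 1) (e ∘ s) * ιMulti ℂ (n + 1) (g ∘ s)), Fintype.sum_prod_type,
      Finset.sum_mul, Finset.sum_range_succ]
    conv_rhs => rw [Finset.smul_sum]
    refine Finset.sum_congr rfl fun i _ => ?_
    rw [mul_smul_comm, Finset.mul_sum, pow_add, mul_smul]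
    congr 1
    rw [Finset.smul_sum]
    refine Finset.sum_congr rfl fun s _ => ?_
    have he : ∀ e : κ → M, ιMulti ℂ (n + 1) (e ∘ (Fin.consEquiv (fun _ => κ)) (i, s))
        = ι ℂ (e i) * ιMulti ℂ n (e ∘ s) := by
      intro e
      rw [ιMulti_succ_apply]
      rfl
    rw [he, he]
    calc _ = ι ℂ (e i) * (ι ℂ (g i) * ιMulti ℂ n (e ∘ s)) * ιMulti ℂ n (g ∘ s) := by
          simp only [mul_assoc]
      _ = _ := by
          rw [aux_comm]
          simp only [mul_assoc, mul_smul_comm, smul_mul_assoc]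

lemma aux_filter (n : ℕ) (i : Fin (n + 1)) :
    (List.finRange (n + 1)).filter (fun k => k ≠ i) = List.ofFn i.succAbove := by
  refine List.SortedLT.eq_of_mem_iff ?_ ?_ ?_
  · exact ((List.pairwise_lt_finRange _).filter _).sortedLT
  · exact (Fin.strictMono_succAbove i).sortedLT_ofFn
  · intro a
    simp only [List.mem_filter, List.mem_finRange, List.mem_ofFn, true_and, decide_eq_true_eq]
    rw [← Set.mem_range, Fin.range_succAbove]
    simp

lemma aux_det (n : ℕ) (B : Matrix (Fin n) (Fin (n + 1)) ℂ) (f : Fin (n + 1) → M) :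
    ιMulti ℂ n (fun k => ∑ j, B k j • f j) = ∑ j : Fin (n + 1),
      (B.submatrix id j.succAbove).det • ιMulti ℂ n (f ∘ j.succAbove) := by
  have h := (ιMulti ℂ n (M := M)).toMultilinearMap.map_sum (fun k j => B k j • f j)
  simp only [AlternatingMap.coe_multilinearMap] at h
  rw [h]
  have h2 : ∀ r : Fin n → Fin (n + 1), ιMulti ℂ n (fun k => B k (r k) • f (r k)) =
      (∏ k, B k (r k)) • ιMulti ℂ n (f ∘ r) := fun r =>
    (ιMulti ℂ n).map_smul_univ (fun k => B k (r k)) (f ∘ r)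
  simp only [h2]
  rw [aux_sum_inj n (fun r => (∏ k, B k (r k)) • ιMulti ℂ n (f ∘ r))]
  · refine Finset.sum_congr rfl fun j _ => ?_
    rw [← Matrix.det_transpose, Matrix.det_apply, Finset.sum_smul]
    refine Finset.sum_congr rfl fun σ _ => ?_
    rw [← Function.comp_assoc, AlternatingMap.map_perm, smul_comm, smul_assoc]
    rfl
  · intro s hs
    rw [ιMulti_eq_zero_of_not_inj, smul_zero]
    exact fun h => hs (Function.Injective.of_comp h)

lemma aux_hatE (n : ℕ) (i : Fin (n + 1)) : hatE (n + 1) i =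
    ιMulti ℂ n ((fun k => Pi.single (Sum.inl k) (1 : ℂ)) ∘ i.succAbove) := by
  rw [hatE, aux_filter, List.map_ofFn, ιMulti_apply]
  rfl

lemma aux_hatF (n : ℕ) (i : Fin (n + 1)) : hatF (n + 1) i =
    ιMulti ℂ n ((fun k => Pi.single (Sum.inr k) (1 : ℂ)) ∘ i.succAbove) := by
  rw [hatF, aux_filter, List.map_ofFn, ιMulti_apply]
  rfl

lemma aux_I (n : ℕ) : Complex.I ^ n * (-1 : ℂ) ^ (∑ k ∈ Finset.range n, k)
    = Complex.I ^ (n ^ 2) := by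
  rw [← Complex.I_sq, ← pow_mul, ← pow_add, mul_comm 2, Finset.sum_range_id_mul_two]
  congr 1
  cases n with
  | zero => rfl
  | succ n => simp; ring

end helpers

/-- (Equation (1) of the paper.)  Let `A` be an `(n+1) × (n+1)` complex
matrix (so the size is `≥ 1`).  In `Λ(ℂ^{2(n+1)})`, with
`ω := i ⬝ Σ_{i,j} a_{ij} e_i ∧ f_j`, one has
`ω^n = n! ⬝ i^{n²} ⬝ Σ_{i,j} (-1)^{i+j} c_{ij} (e_1∧…∧ê_i∧…) ∧ (f_1∧…∧f̂_j∧…)`,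
where `c_{ij}` is the `(i,j)` cofactor of `A`. -/
theorem pow_of_I_smul_sum_smul_wedge (n : ℕ)
    (A : Matrix (Fin (n + 1)) (Fin (n + 1)) ℂ) :
    (Complex.I • ∑ i : Fin (n + 1), ∑ j : Fin (n + 1),
        A i j • (eVec (n + 1) i * fVec (n + 1) j)) ^ n
      = (n.factorial : ℂ) • (Complex.I ^ (n ^ 2)) •
          ∑ i : Fin (n + 1), ∑ j : Fin (n + 1),
            ((-1 : ℂ) ^ ((i : ℕ) + (j : ℕ)) * cofactor n A i j) •
              (hatE (n + 1) i * hatF (n + 1) j) := by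
  have h0 : ∑ i : Fin (n + 1), ∑ j : Fin (n + 1), A i j • (eVec (n + 1) i * fVec (n + 1) j)
      = ∑ i : Fin (n + 1), ι ℂ ((fun k => (Pi.single (Sum.inl k) (1 : ℂ) :
          (Fin (n + 1) ⊕ Fin (n + 1)) → ℂ)) i) *
        ι ℂ ((fun i => ∑ j, A i j • (fun k => (Pi.single (Sum.inr k) (1 : ℂ) :
          (Fin (n + 1) ⊕ Fin (n + 1)) → ℂ)) j) i) := by
    refine Finset.sum_congr rfl fun i _ => ?_
    simp only [map_sum, map_smul, Finset.mul_sum, mul_smul_comm]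
    rfl
  rw [smul_pow, h0, aux_pow, smul_smul, aux_I, smul_comm (n.factorial : ℂ)]
  congr 1
  rw [aux_sum_inj, Finset.smul_sum]
  · refine Finset.sum_congr rfl fun i _ => ?_
    have hc : ∀ σ : Equiv.Perm (Fin n), ∀ x y :
        ExteriorAlgebra ℂ ((Fin (n + 1) ⊕ Fin (n + 1)) → ℂ),
        (Equiv.Perm.sign σ • x) * (Equiv.Perm.sign σ • y) = x * y := by
      intro σ x y
      rcases Int.units_eq_one_or (Equiv.Perm.sign σ) with h | h <;> simp [h]
    simp only [← Function.comp_assoc, AlternatingMap.map_perm, hc]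
    rw [Finset.sum_const, Finset.card_univ, Fintype.card_perm, Fintype.card_fin,
      ← Nat.cast_smul_eq_nsmul ℂ, ← aux_hatE]
    congr 1
    have hd := aux_det n (A.submatrix i.succAbove id) (fun k => (Pi.single (Sum.inr k) (1 : ℂ) :
          (Fin (n + 1) ⊕ Fin (n + 1)) → ℂ))
    refine (congrArg (hatE (n + 1) i * ·) hd).trans ?_
    simp only [← aux_hatF, Finset.mul_sum, mul_smul_comm]
    refine Finset.sum_congr rfl fun j _ => ?_
    rw [cofactor, ← mul_assoc, ← mul_pow]
    simp
  · intro s hs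
    rw [ιMulti_eq_zero_of_not_inj, zero_mul]
    exact fun h => hs (Function.Injective.of_comp h)
end

section
/- Let n ≥ 2 and let B be a positive definite Hermitian n×n complex matrix. Define A := (det B)^{1/(n-1)} · B^{-1}, where det B is a positive real number and (det B)^{1/(n-1)} denotes its positive real (n-1)-st root. Then A is a positive definite Hermitian matrix and adj A = B, where adj A denotes the adjugate of A. -/
open ComplexOrder

/-- For `n ≥ 2` and a positive definite Hermitian `n × n` complex matrix `B`,
the matrix `A := (det B)^(1/(n-1)) • B⁻¹` (with the positive real `(n-1)`-st root of the
positive real number `det B`) is positive definite Hermitian and satisfies `adj A = B`. -/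
theorem root_det_smul_inv_posDef_and_adjugate_eq
    (n : ℕ) (hn : 2 ≤ n) (B : Matrix (Fin n) (Fin n) ℂ) (hB : B.PosDef) :
    ((((B.det.re ^ ((n - 1 : ℝ)⁻¹) : ℝ)) : ℂ) • B⁻¹).PosDef ∧
      ((((B.det.re ^ ((n - 1 : ℝ)⁻¹) : ℝ)) : ℂ) • B⁻¹).adjugate = B := by
  have hd : 0 < B.det := hB.det_pos
  have hre : 0 < B.det.re := (Complex.pos_iff.mp hd).1
  have hdet : ((B.det.re : ℝ) : ℂ) = B.det :=
    Complex.ext (by simp) (by simpa using (Complex.pos_iff.mp hd).2)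
  have hu : IsUnit B.det := isUnit_iff_ne_zero.mpr hd.ne'
  have hr : 0 < B.det.re ^ ((n - 1 : ℝ)⁻¹) := Real.rpow_pos_of_pos hre _
  refine ⟨hB.inv.smul (by exact_mod_cast hr), ?_⟩
  have hpow : (B.det.re ^ ((n - 1 : ℝ)⁻¹)) ^ (n - 1) = B.det.re := by
    have h : ((n - 1 : ℝ)⁻¹) = (((n - 1 : ℕ) : ℝ))⁻¹ := by
      rw [Nat.cast_sub (by omega)]; simp
    rw [h]
    exact Real.rpow_inv_natCast_pow hre.le (by omega)
  have hadj : (B⁻¹).adjugate = (B.det)⁻¹ • B := by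
    calc (B⁻¹).adjugate = (B⁻¹).adjugate * (B⁻¹ * B) := by
          rw [Matrix.nonsing_inv_mul B hu, mul_one]
      _ = (B.det)⁻¹ • B := by
          rw [← mul_assoc, Matrix.adjugate_mul, Matrix.det_nonsing_inv, Ring.inverse_eq_inv',
            Matrix.smul_mul, one_mul]
  rw [Matrix.adjugate_smul, hadj, Fintype.card_fin, ← Complex.ofReal_pow, hpow, hdet, smul_smul,
    mul_inv_cancel₀ hd.ne', one_smul]
end

section
/- Let n ≥ 2 and let A and A' be positive definite Hermitian n×n complex matrices with adj A = adj A', where adj denotes the adjugate. Then A = A'. -/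
open ComplexOrder

/-- For `n ≥ 2`, two positive definite Hermitian `n × n` complex matrices
with the same adjugate coincide. -/
theorem posDef_adjugate_injective
    (n : ℕ) (hn : 2 ≤ n) (A A' : Matrix (Fin n) (Fin n) ℂ)
    (hA : A.PosDef) (hA' : A'.PosDef) (h : A.adjugate = A'.adjugate) :
    A = A' := by
  have key : A.det = A'.det := by
    have hp := hA.det_pos
    have hp' := hA'.det_pos
    have hd : A.det ^ (n - 1) = A'.det ^ (n - 1) := by
      have h1 := congrArg Matrix.det h
      simpa only [Matrix.det_adjugate, Fintype.card_fin] using h1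
    have hn1 : n - 1 ≠ 0 := by omega
    have hnorm : ‖A.det‖ = ‖A'.det‖ := by
      have h2 := congrArg norm hd
      rw [norm_pow, norm_pow] at h2
      exact (pow_left_inj₀ (norm_nonneg _) (norm_nonneg _) hn1).1 h2
    have e := Complex.eq_coe_norm_of_nonneg hp.le
    have e' := Complex.eq_coe_norm_of_nonneg hp'.le
    rw [e, e', hnorm]
  have h0 : A.det ≠ 0 := hA.det_pos.ne'
  have h3 : A.det • A = A.det • A' := by
    calc A.det • A = (A * A.adjugate) * A := by rw [Matrix.mul_adjugate]; simp
      _ = (A' * A.adjugate) * A := by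
        rw [Matrix.mul_adjugate, h, Matrix.mul_adjugate, key]
      _ = A.det • A' := by rw [Matrix.mul_assoc, Matrix.adjugate_mul]; simp
  exact smul_right_injective _ h0 h3
end

section
/- Let n ≥ 2 and let B be a positive definite Hermitian n×n complex matrix. Then there exists a unique positive definite Hermitian n×n complex matrix A such that adj A = B, where adj A denotes the adjugate of A; explicitly, A = (det B)^{1/(n-1)} · B^{-1}. -/
open ComplexOrder

/-- For `n ≥ 2` and a positive definite Hermitian `n × n` complex matrix `B`,
there exists a unique positive definite Hermitian matrix `A` with `adj A = B`; explicitly,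
`A = (det B)^(1/(n-1)) • B⁻¹`, with the positive real `(n-1)`-st root of the positive real
number `det B`. -/
theorem existsUnique_posDef_adjugate_eq
    (n : ℕ) (hn : 2 ≤ n) (B : Matrix (Fin n) (Fin n) ℂ) (hB : B.PosDef) :
    (∃! A : Matrix (Fin n) (Fin n) ℂ, A.PosDef ∧ A.adjugate = B) ∧
      ∀ A : Matrix (Fin n) (Fin n) ℂ, A.PosDef → A.adjugate = B →
        A = ((((B.det.re ^ ((n - 1 : ℝ)⁻¹) : ℝ)) : ℂ) • B⁻¹) := by
  have key : ∀ M : Matrix (Fin n) (Fin n) ℂ, M.PosDef →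
      0 < M.det.re ∧ M.det = (M.det.re : ℂ) := by
    intro M hM
    have h := Complex.pos_iff.mp hM.det_pos
    exact ⟨h.1, Complex.ext (by simp) (by simp [← h.2])⟩
  have hn1 : ((n - 1 : ℕ) : ℝ) = (n : ℝ) - 1 := by
    rw [Nat.cast_sub (by omega)]; simp
  have hne : n - 1 ≠ 0 := by omega
  obtain ⟨hr, hrB⟩ := key B hB
  have hBu : IsUnit B.det := (Matrix.isUnit_iff_isUnit_det B).mp hB.isUnit
  have huniq : ∀ A : Matrix (Fin n) (Fin n) ℂ, A.PosDef → A.adjugate = B →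
        A = ((((B.det.re ^ ((n - 1 : ℝ)⁻¹) : ℝ)) : ℂ) • B⁻¹) := by
    intro A hA hAB
    obtain ⟨ha, haA⟩ := key A hA
    have h1 : A * B = A.det • (1 : Matrix (Fin n) (Fin n) ℂ) := by
      rw [← hAB, Matrix.mul_adjugate]
    have h2 : B.det = A.det ^ (n - 1) := by
      rw [← hAB, Matrix.det_adjugate, Fintype.card_fin]
    have h3 : B.det.re = A.det.re ^ (n - 1) := by
      rw [hrB, haA] at h2
      exact_mod_cast h2
    have h4 : B.det.re ^ ((n - 1 : ℝ)⁻¹) = A.det.re := by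
      rw [h3, ← hn1, Real.pow_rpow_inv_natCast ha.le hne]
    rw [h4, ← haA]
    calc A = A * B * B⁻¹ := (Matrix.mul_nonsing_inv_cancel_right B A hBu).symm
      _ = _ := by rw [h1, Matrix.smul_mul, Matrix.one_mul]
  refine ⟨⟨_, ⟨?_, ?_⟩, fun A hA => huniq A hA.1 hA.2⟩, huniq⟩
  · apply hB.inv.smul
    exact_mod_cast Real.rpow_pos_of_pos hr _
  · have hc : ((B.det.re ^ ((n - 1 : ℝ)⁻¹) : ℝ) : ℂ) ^ (n - 1) = B.det := by
      rw [hrB, ← Complex.ofReal_pow, Complex.ofReal_re, ← hn1,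
        Real.rpow_inv_natCast_pow hr.le hne]
    rw [Matrix.adjugate_smul, Fintype.card_fin, hc]
    have h5 : B * (B⁻¹ * B⁻¹.adjugate) = B⁻¹.adjugate := by
      rw [← Matrix.mul_assoc, Matrix.mul_nonsing_inv B hBu, Matrix.one_mul]
    rw [← h5, Matrix.mul_adjugate, Matrix.mul_smul, Matrix.mul_one, smul_smul,
      ← Matrix.det_mul, Matrix.mul_nonsing_inv B hBu, Matrix.det_one, one_smul]
end
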